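/- Horton's law of stream numbers for the random model: for every fixed order r ≥ 1, the bifurcation ratio S_{r+1,n}/S_{r,n} converges in probability to 1/4 as n → ∞; that is, for every ε > 0, P_n(|S_{r+1,n}/S_{r,n} − 1/4| > ε) → 0 as n → ∞. -/

import Mathlib

open MeasureTheory ProbabilityTheory Filter
open scoped NNReal Topology

/-- Binary trees: every internal node has exactly two children. -/
inductive BinTree : Type
  | leaf : BinTree
  | node : BinTree → BinTree → BinTree
  deriving DecidableEq

namespace BinTree

/-- The magnitude of a binary tree is its number of leaves. -/
def magnitude : BinTree → ℕ
  | leaf => 1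
  | node l r => magnitude l + magnitude r

/-- The Horton–Strahler order of (the root of) a binary tree:
leaves have order 1; a node whose two children have distinct orders has the max of the two;
a node whose two children have equal order `r` has order `r + 1`. -/
def ord : BinTree → ℕ
  | leaf => 1
  | node l r => if ord l = ord r then ord l + 1 else max (ord l) (ord r)

/-- `branches k τ` is `S_{k,n}(τ)`, the number of Horton–Strahler branches of order `k`
in `τ`, i.e. the number of maximal connected paths of nodes of order `k`.  It counts the
nodes of order `k` that head a branch: a new branch head of order `ord l + 1` is created
exactly at a node whose two children have equal order `ord l`, and every leaf heads an
order-1 branch. -/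
def branches (k : ℕ) : BinTree → ℕ
  | leaf => if k = 1 then 1 else 0
  | node l r => branches k l + branches k r +
      (if ord l = ord r ∧ ord l + 1 = k then 1 else 0)

end BinTree

/-- `treesOf n` is the finite set `Ω_n` of binary trees of magnitude `n`. -/
def treesOf : ℕ → Finset BinTree
  | 0 => ∅
  | 1 => {BinTree.leaf}
  | (n+2) => (Finset.range (n+1)).attach.biUnion fun k =>
      ((treesOf (k.1+1)) ×ˢ (treesOf (n+1-k.1))).image fun p => BinTree.node p.1 p.2
  decreasing_by
  · have := Finset.mem_range.mp k.2; omega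
  · omega

/-- Expectation `⟨f⟩` under the uniform probability measure `P_n` on `Ω_n` (the random model). -/
noncomputable def expect (n : ℕ) (f : BinTree → ℝ) : ℝ :=
  (∑ τ ∈ treesOf n, f τ) / (treesOf n).card

namespace BinTree

theorem magnitude_pos (τ : BinTree) : 0 < τ.magnitude := by
  induction τ with
  | leaf => simp [magnitude]
  | node l r hl hr => simp only [magnitude]; omega

theorem ord_pos (τ : BinTree) : 0 < τ.ord := by
  induction τ with
  | leaf => simp [ord]
  | node l r hl hr => simp only [ord]; split_ifs <;> omega

theorem branches_one (τ : BinTree) : τ.branches 1 = τ.magnitude := by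
  induction τ with
  | leaf => simp [branches, magnitude]
  | node l r hl hr => simp [branches, magnitude, hl, hr, (ord_pos l).ne']

/-- Pruning a tree: remove all leaves and suppress the nodes with a single remaining child.
Nothing remains exactly when the tree is a single leaf. -/
def prune : BinTree → Option BinTree
  | leaf => none
  | node l r =>
    match prune l, prune r with
    | none, none => some leaf
    | some a, none => some a
    | none, some b => some b
    | some a, some b => some (node a b)

theorem prune_eq_none_iff {τ : BinTree} : τ.prune = none ↔ τ = leaf := by
  cases τ with
  | leaf => simp [prune]
  | node l r => simp only [prune]; split <;> simp

theorem ord_of_prune_eq_some {τ σ : BinTree} (h : τ.prune = some σ) : τ.ord = σ.ord + 1 := by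
  induction τ generalizing σ with
  | leaf => simp [prune] at h
  | node l r hl hr =>
    simp only [prune] at h
    split at h
    · rename_i h1 h2
      rw [prune_eq_none_iff] at h1 h2
      subst h1 h2
      simp only [Option.some.injEq] at h
      subst h
      simp [ord]
    · rename_i a h1 h2
      rw [prune_eq_none_iff] at h2
      simp only [Option.some.injEq] at h
      subst h h2
      have := hl h1
      have := ord_pos a
      simp only [ord]
      grind
    · rename_i b h1 h2
      rw [prune_eq_none_iff] at h1
      simp only [Option.some.injEq] at h
      subst h h1
      have := hr h2
      have := ord_pos b
      simp only [ord]
      grind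
    · rename_i a b h1 h2
      simp only [Option.some.injEq] at h
      subst h
      have := hl h1
      have := hr h2
      simp only [ord]
      grind

theorem branches_of_prune_eq_some {k : ℕ} (hk : 1 ≤ k) {τ σ : BinTree} (h : τ.prune = some σ) :
    τ.branches (k + 1) = σ.branches k := by
  induction τ generalizing σ with
  | leaf => simp [prune] at h
  | node l r hl hr =>
    simp only [prune] at h
    split at h
    · rename_i h1 h2
      rw [prune_eq_none_iff] at h1 h2
      subst h1 h2
      simp only [Option.some.injEq] at h
      subst h
      simp only [branches, ord]
      grind
    · rename_i a h1 h2
      rw [prune_eq_none_iff] at h2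
      simp only [Option.some.injEq] at h
      subst h h2
      have := ord_of_prune_eq_some h1
      have := ord_pos a
      simp only [branches, hl h1, ord]
      grind
    · rename_i b h1 h2
      rw [prune_eq_none_iff] at h1
      simp only [Option.some.injEq] at h
      subst h h1
      have := ord_of_prune_eq_some h2
      have := ord_pos b
      simp only [branches, hr h2, ord]
      grind
    · rename_i a b h1 h2
      simp only [Option.some.injEq] at h
      subst h
      have := ord_of_prune_eq_some h1
      have := ord_of_prune_eq_some h2
      simp only [branches, hl h1, hr h2]
      grind

theorem magnitude_le_of_prune_eq_some {τ σ : BinTree} (h : τ.prune = some σ) :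
    σ.magnitude ≤ τ.magnitude := by
  induction τ generalizing σ with
  | leaf => simp [prune] at h
  | node l r hl hr =>
    have := magnitude_pos l
    simp only [prune] at h
    split at h <;> simp only [Option.some.injEq] at h <;> subst h <;> rename_i h1 h2 <;>
      simp only [magnitude]
    · omega
    · have := hl h1
      omega
    · have := hr h2
      omega
    · have := hl h1
      have := hr h2
      omega

end BinTree

open BinTree

theorem mem_treesOf {n : ℕ} {τ : BinTree} : τ ∈ treesOf n ↔ τ.magnitude = n := by
  induction n using Nat.strong_induction_on generalizing τ with
  | _ n ih =>
    have hpos := magnitude_pos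
    match n with
    | 0 => simpa [treesOf] using (hpos τ).ne'
    | 1 =>
      cases τ with
      | leaf => simp [treesOf, magnitude]
      | node l r =>
        have := hpos l
        have := hpos r
        simp only [treesOf, Finset.mem_singleton, reduceCtorEq, magnitude, false_iff]
        omega
    | n + 2 =>
      cases τ with
      | leaf => simp [treesOf, magnitude]
      | node l r =>
        simp only [treesOf, Finset.mem_biUnion, Finset.mem_attach, true_and, Subtype.exists,
          Finset.mem_image, Finset.mem_product, Prod.exists, node.injEq, Finset.mem_range,
          magnitude]
        constructor
        · rintro ⟨k, hk, a, b, ⟨ha, hb⟩, rfl, rfl⟩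
          rw [ih _ (by omega)] at ha hb
          omega
        · intro h
          have := hpos l
          have := hpos r
          refine ⟨l.magnitude - 1, by omega, l, r, ⟨?_, ?_⟩, rfl, rfl⟩ <;>
            rw [ih _ (by omega)] <;> omega

theorem sum_treesOf {f : BinTree → ℝ} {n : ℕ} :
    ∑ τ ∈ treesOf n, f τ = (if n = 1 then f leaf else 0) +
      ∑ p ∈ Finset.HasAntidiagonal.antidiagonal n,
        ∑ l ∈ treesOf p.1, ∑ r ∈ treesOf p.2, f (node l r) := by
  have hnode : ∑ p ∈ Finset.HasAntidiagonal.antidiagonal n,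
      ∑ l ∈ treesOf p.1, ∑ r ∈ treesOf p.2, f (node l r) =
      ∑ τ ∈ (treesOf n).filter (· ≠ leaf), f τ := by
    simp_rw [← Finset.sum_product']
    rw [Finset.sum_sigma']
    refine Finset.sum_bij (fun x _ => node x.2.1 x.2.2) ?_ ?_ ?_ (fun _ _ => rfl)
    · rintro ⟨p, l, r⟩ h
      simp_all [mem_treesOf, magnitude]
    · rintro ⟨⟨i, j⟩, l, r⟩ h ⟨⟨i', j'⟩, l', r'⟩ h' heq
      simp_all [mem_treesOf]
    · rintro (_ | ⟨l, r⟩) h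
      · simp at h
      · exact ⟨⟨(l.magnitude, r.magnitude), l, r⟩, by simp_all [mem_treesOf, magnitude], rfl⟩
  rw [hnode, ← Finset.sum_filter_add_sum_filter_not (treesOf n) (· = leaf)]
  congr 1
  split_ifs with h
  · subst h
    simp [treesOf, Finset.filter_singleton]
  · refine Finset.sum_eq_zero fun τ hτ => ?_
    simp only [Finset.mem_filter, mem_treesOf] at hτ
    obtain ⟨h1, rfl⟩ := hτ
    exact absurd h1.symm h

theorem card_treesOf_succ (n : ℕ) : (treesOf (n + 1)).card = catalan n := by
  induction n using Nat.strong_induction_on with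
  | _ n ih =>
    match n with
    | 0 => simp [treesOf]
    | n + 1 =>
      have h := sum_treesOf (f := fun _ => 1) (n := n + 1 + 1)
      simp only [Finset.sum_const, nsmul_eq_mul, mul_one] at h
      rw [if_neg (by omega), zero_add, Finset.Nat.antidiagonal_succ_succ'] at h
      simp only [Finset.sum_cons, Finset.sum_map, treesOf.eq_1] at h
      simp only [Finset.card_empty, Nat.cast_zero, zero_mul, mul_zero, zero_add,
        Function.Embedding.prodMap, Function.Embedding.coeFn_mk, Prod.map] at h
      rw [catalan_succ']
      norm_cast at h
      rw [h]
      refine Finset.sum_congr rfl fun p hp => ?_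
      have := Finset.HasAntidiagonal.mem_antidiagonal.mp hp
      exact congr_arg₂ _ (ih _ (by omega)) (ih _ (by omega))

/-- The generating function, by magnitude, of the trees with a given pruning. -/
noncomputable def pruneSeries (o : Option BinTree) : PowerSeries ℝ :=
  PowerSeries.mk fun n => ∑ τ ∈ treesOf n, if τ.prune = o then 1 else 0

open PowerSeries in
theorem pruneSeries_none : pruneSeries none = X := by
  ext n
  rw [pruneSeries, coeff_mk, coeff_X]
  simp only [prune_eq_none_iff, Finset.sum_ite_eq', mem_treesOf, magnitude, eq_comm]

open PowerSeries in
theorem pruneSeries_some (σ : BinTree) (s : Finset (Option BinTree × Option BinTree))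
    (hs : ∀ l r, (node l r).prune = some σ ↔ (l.prune, r.prune) ∈ s) :
    pruneSeries (some σ) = ∑ p ∈ s, pruneSeries p.1 * pruneSeries p.2 := by
  have hnode : ∀ l r, (if (node l r).prune = some σ then (1 : ℝ) else 0) =
      ∑ p ∈ s, (if l.prune = p.1 then 1 else 0) * (if r.prune = p.2 then 1 else 0) := by
    intro l r
    simp_rw [hs, ite_mul, one_mul, zero_mul, ← ite_and, ← Prod.mk_inj, Prod.mk.eta]
    rw [Finset.sum_ite_eq s (l.prune, r.prune) fun _ => (1 : ℝ)]
  ext n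
  simp only [map_sum, coeff_mul, pruneSeries, coeff_mk]
  rw [sum_treesOf, Finset.sum_comm (s := s)]
  simp only [show leaf.prune = none from rfl, reduceCtorEq, if_false, ite_self, zero_add]
  refine Finset.sum_congr rfl fun p _ => ?_
  simp_rw [Finset.sum_mul_sum]
  rw [Finset.sum_comm (s := s)]
  refine Finset.sum_congr rfl fun l _ => ?_
  rw [Finset.sum_comm (s := s)]
  exact Finset.sum_congr rfl fun r _ => hnode l r

open PowerSeries in
theorem pruneSeries_leaf : pruneSeries (some leaf) * (1 - 2 * X) = X ^ 2 := by
  have h := pruneSeries_some leaf {(none, none), (some leaf, none), (none, some leaf)} <| by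
    intro l r
    simp only [prune]
    cases l.prune <;> cases r.prune <;> simp
  rw [Finset.sum_insert (by simp), Finset.sum_insert (by simp), Finset.sum_singleton] at h
  simp only [pruneSeries_none] at h
  linear_combination h

open PowerSeries in
theorem pruneSeries_node (a b : BinTree) :
    pruneSeries (some (node a b)) * (1 - 2 * X) =
      pruneSeries (some a) * pruneSeries (some b) := by
  have h := pruneSeries_some (node a b)
    {(some a, some b), (some (node a b), none), (none, some (node a b))} <| by
    intro l r
    simp only [prune]
    cases l.prune <;> cases r.prune <;> simp
  rw [Finset.sum_insert (by simp), Finset.sum_insert (by simp), Finset.sum_singleton] at h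
  simp only [pruneSeries_none] at h
  linear_combination h

open PowerSeries in
theorem one_sub_two_mul_X_ne_zero : (1 - 2 * X : PowerSeries ℝ) ≠ 0 := by
  intro h
  simpa using congr_arg (constantCoeff (R := ℝ)) h

open PowerSeries in
theorem pruneSeries_mul_pow (σ : BinTree) :
    pruneSeries (some σ) * (1 - 2 * X) ^ (2 * σ.magnitude) =
      X ^ (2 * σ.magnitude) * (1 - 2 * X) := by
  induction σ with
  | leaf =>
    simp only [magnitude]
    linear_combination (1 - 2 * X) * pruneSeries_leaf
  | node a b ha hb =>
    refine mul_right_cancel₀ one_sub_two_mul_X_ne_zero ?_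
    simp only [magnitude, mul_add, pow_add]
    linear_combination (1 - 2 * X) ^ (2 * a.magnitude) * (1 - 2 * X) ^ (2 * b.magnitude) *
      pruneSeries_node a b + pruneSeries (some a) * (1 - 2 * X) ^ (2 * a.magnitude) * hb +
      X ^ (2 * b.magnitude) * (1 - 2 * X) * ha

/-- The number of trees of magnitude `n` with a given pruning of magnitude `m`. -/
noncomputable def pruneFiber (n m : ℕ) : ℝ :=
  if 2 * m ≤ n then ((n - 2).choose (2 * m - 2) : ℝ) * 2 ^ (n - 2 * m) else 0

open PowerSeries in
theorem mk_choose_mul_two_pow_mul (d : ℕ) :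
    (PowerSeries.mk fun n => ((d + n).choose d : ℝ) * 2 ^ n) * (1 - 2 * X) ^ (d + 1) = 1 := by
  have h := congr_arg (rescale (2 : ℝ)) (mk_add_choose_mul_one_sub_pow_eq_one ℝ d)
  simp only [map_mul, map_pow, map_sub, map_one, rescale_X, rescale_mk] at h
  simpa only [mul_comm, map_ofNat] using h

open PowerSeries in
theorem card_prune_eq (n : ℕ) (σ : BinTree) :
    ∑ τ ∈ treesOf n, (if τ.prune = some σ then (1 : ℝ) else 0) = pruneFiber n σ.magnitude := by
  obtain ⟨k, hk⟩ : ∃ k, σ.magnitude = k + 1 := ⟨_, (Nat.succ_pred (magnitude_pos σ).ne').symm⟩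
  have h : pruneSeries (some σ) = X ^ (2 * σ.magnitude) *
      PowerSeries.mk fun n => ((2 * k + n).choose (2 * k) : ℝ) * 2 ^ n := by
    refine mul_right_cancel₀ (pow_ne_zero (2 * σ.magnitude) one_sub_two_mul_X_ne_zero) ?_
    rw [pruneSeries_mul_pow, hk, show 2 * (k + 1) = 2 * k + 1 + 1 by ring, pow_succ (1 - 2 * X)]
    linear_combination -X ^ (2 * k + 1 + 1) * (1 - 2 * X) * mk_choose_mul_two_pow_mul (2 * k)
  have h := congr_arg (coeff n) h
  rw [pruneSeries, coeff_mk, coeff_X_pow_mul'] at h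
  rw [h, pruneFiber]
  split_ifs with hn
  · rw [coeff_mk, hk]
    congr 3
    omega
  · rfl

/-- Sums over trees that factor through pruning. -/
theorem sum_treesOf_of_prune {n : ℕ} (hn : 2 ≤ n) {f h : BinTree → ℝ}
    (hfh : ∀ τ σ, τ.magnitude = n → τ.prune = some σ → f τ = h σ) :
    ∑ τ ∈ treesOf n, f τ =
      ∑ m ∈ Finset.range (n + 1), pruneFiber n m * ∑ σ ∈ treesOf m, h σ := by
  have hfib : ∀ m, pruneFiber n m * ∑ σ ∈ treesOf m, h σ =
      ∑ τ ∈ treesOf n, ∑ σ ∈ treesOf m, if τ.prune = some σ then h σ else 0 := by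
    intro m
    rw [Finset.sum_comm, Finset.mul_sum]
    refine Finset.sum_congr rfl fun σ hσ => ?_
    rw [← mem_treesOf.mp hσ, ← card_prune_eq, Finset.sum_mul]
    simp
  simp_rw [hfib]
  rw [Finset.sum_comm]
  refine Finset.sum_congr rfl fun τ hτ => ?_
  rw [mem_treesOf] at hτ
  obtain ⟨σ, hσ⟩ : ∃ σ, τ.prune = some σ := by
    rw [← Option.ne_none_iff_exists', Ne, prune_eq_none_iff]
    rintro rfl
    simp only [magnitude] at hτ
    omega
  have hle := magnitude_le_of_prune_eq_some hσ
  rw [Finset.sum_eq_single σ.magnitude, Finset.sum_eq_single σ, if_pos hσ, hfh τ σ hτ hσ]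
  · intro ρ _ hne
    rw [hσ, if_neg (by simpa using hne.symm)]
  · simp [mem_treesOf]
  · intro m _ hne
    refine Finset.sum_eq_zero fun ρ hρ => if_neg ?_
    rw [hσ]
    rintro ⟨⟩
    exact hne (mem_treesOf.mp hρ).symm
  · simp only [Finset.mem_range]
    omega

theorem card_treesOf_pos {n : ℕ} (hn : 1 ≤ n) : (0 : ℝ) < (treesOf n).card := by
  obtain ⟨n, rfl⟩ := Nat.exists_eq_add_of_le' hn
  have h := succ_mul_catalan_eq_centralBinom n
  have := Nat.centralBinom_pos n
  rw [card_treesOf_succ, Nat.cast_pos]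
  refine Nat.pos_of_ne_zero fun h0 => ?_
  rw [h0] at h
  omega

theorem succ_succ_mul_catalan_succ (n : ℕ) :
    (n + 2) * catalan (n + 1) = 2 * (2 * n + 1) * catalan n := by
  refine Nat.eq_of_mul_eq_mul_left (Nat.succ_pos n) ?_
  have h1 := succ_mul_catalan_eq_centralBinom n
  have h2 := succ_mul_catalan_eq_centralBinom (n + 1)
  have h3 := Nat.succ_mul_centralBinom_succ n
  rw [← h1, ← h2] at h3
  simp only [Nat.succ_eq_add_one]
  linarith

/-- The probability that a random tree of magnitude `n` has pruning of magnitude `m`. -/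
noncomputable def pruneLaw (n m : ℕ) : ℝ :=
  pruneFiber n m * (treesOf m).card / (treesOf n).card

theorem pruneLaw_nonneg (n m : ℕ) : 0 ≤ pruneLaw n m := by
  rw [pruneLaw, pruneFiber]
  positivity

theorem sum_pruneLaw {n : ℕ} (hn : 2 ≤ n) : ∑ m ∈ Finset.range (n + 1), pruneLaw n m = 1 := by
  have h := sum_treesOf_of_prune hn (f := fun _ => 1) (h := fun _ => 1) (fun _ _ _ _ => rfl)
  simp only [Finset.sum_const, nsmul_eq_mul, mul_one] at h
  simp_rw [pruneLaw]
  rw [← Finset.sum_div, ← h, div_self (card_treesOf_pos (by omega)).ne']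

theorem pruneLaw_succ {n : ℕ} (hn : 2 ≤ n) (m : ℕ) :
    pruneLaw n (m + 1) * (4 * m * (m + 1)) =
      pruneLaw n m * ((n - 2 * m) * (n - 2 * m - 1)) := by
  simp only [pruneLaw, div_mul_eq_mul_div]
  congr 1
  rcases m with _ | k
  · simp [treesOf]
  rw [card_treesOf_succ, card_treesOf_succ]
  rcases Nat.lt_or_ge n (2 * (k + 1) + 2) with hlt | hge
  · rw [pruneFiber, if_neg (by omega)]
    by_cases h : 2 * (k + 1) ≤ n
    · obtain rfl | rfl : n = 2 * (k + 1) ∨ n = 2 * (k + 1) + 1 := by omega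
      all_goals push_cast; ring
    · rw [pruneFiber, if_neg h]
      ring
  · obtain ⟨i, rfl⟩ := Nat.exists_eq_add_of_le hge
    rw [pruneFiber, pruneFiber, if_pos (by omega), if_pos (by omega),
      show 2 * (k + 1) + 2 + i - 2 = 2 * k + i + 2 by omega,
      show 2 * (k + 1 + 1) - 2 = 2 * k + 1 + 1 by omega,
      show 2 * (k + 1) + 2 + i - 2 * (k + 1 + 1) = i by omega,
      show 2 * (k + 1) - 2 = 2 * k by omega,
      show 2 * (k + 1) + 2 + i - 2 * (k + 1) = i + 2 by omega]
    have h1 := Nat.choose_succ_right_eq (2 * k + i + 2) (2 * k + 1)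
    have h2 := Nat.choose_succ_right_eq (2 * k + i + 2) (2 * k)
    rw [show 2 * k + i + 2 - (2 * k + 1) = i + 1 by omega] at h1
    rw [show 2 * k + i + 2 - 2 * k = i + 2 by omega] at h2
    have h3 := succ_succ_mul_catalan_succ k
    rify at h1 h2 h3
    push_cast
    generalize ((2 * k + i + 2).choose (2 * k + 1 + 1) : ℝ) = c2 at *
    generalize ((2 * k + i + 2).choose (2 * k + 1) : ℝ) = c1 at *
    generalize ((2 * k + i + 2).choose (2 * k) : ℝ) = c0 at *
    linear_combination 4 * 2 ^ i * (k + 1) * c2 * h3 + 4 * 2 ^ i * catalan k * (2 * k + 1) * h1 +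
      4 * 2 ^ i * catalan k * (i + 1) * h2

theorem sum_pruneLaw_mul_shift {n : ℕ} (hn : 2 ≤ n) (h : ℝ → ℝ) :
    ∑ m ∈ Finset.range (n + 1), pruneLaw n m * (4 * (m - 1) * m * h m) =
      ∑ m ∈ Finset.range (n + 1), pruneLaw n m * ((n - 2 * m) * (n - 2 * m - 1) * h (m + 1)) := by
  rw [Finset.sum_range_succ', Finset.sum_range_succ (n := n)]
  have h0 : pruneLaw n n = 0 := by
    rw [pruneLaw, pruneFiber, if_neg (by omega)]
    simp
  rw [h0]
  simp only [Nat.cast_zero, mul_zero, zero_mul, add_zero]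
  refine Finset.sum_congr rfl fun m _ => ?_
  push_cast
  linear_combination h (m + 1) * pruneLaw_succ hn m

/-- The first moment of the magnitude of the pruning. -/
theorem pruneLaw_first_moment {n : ℕ} (hn : 2 ≤ n) :
    (4 * n - 6) * ∑ m ∈ Finset.range (n + 1), pruneLaw n m * m = (n * (n - 1) : ℝ) := by
  have h := sum_pruneLaw_mul_shift hn fun _ => 1
  have h1 := sum_pruneLaw hn
  have hsum : (4 * n - 6) * ∑ m ∈ Finset.range (n + 1), pruneLaw n m * m =
      n * (n - 1) * ∑ m ∈ Finset.range (n + 1), pruneLaw n m := by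
    rw [← sub_eq_zero, ← Finset.sum_sub_distrib] at h
    rw [← sub_eq_zero, Finset.mul_sum, Finset.mul_sum, ← Finset.sum_sub_distrib, ← h]
    exact Finset.sum_congr rfl fun m _ => by ring
  rw [hsum, h1, mul_one]

/-- The second moment of the magnitude of the pruning. -/
theorem pruneLaw_second_moment {n : ℕ} (hn : 2 ≤ n) :
    (4 * n - 10) * ∑ m ∈ Finset.range (n + 1), pruneLaw n m * (m : ℝ) ^ 2 =
      (n ^ 2 - 5 * n + 2 : ℝ) * (∑ m ∈ Finset.range (n + 1), pruneLaw n m * m) +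
        n * (n - 1) := by
  have h := sum_pruneLaw_mul_shift hn id
  have h1 := sum_pruneLaw hn
  have hsum : (4 * n - 10) * ∑ m ∈ Finset.range (n + 1), pruneLaw n m * (m : ℝ) ^ 2 =
      (n ^ 2 - 5 * n + 2 : ℝ) * (∑ m ∈ Finset.range (n + 1), pruneLaw n m * m) +
        n * (n - 1) * ∑ m ∈ Finset.range (n + 1), pruneLaw n m := by
    rw [← sub_eq_zero, ← Finset.sum_sub_distrib] at h
    rw [← sub_eq_zero, Finset.mul_sum, Finset.mul_sum, Finset.mul_sum, ← Finset.sum_add_distrib,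
      ← Finset.sum_sub_distrib, ← h]
    exact Finset.sum_congr rfl fun m _ => by simp only [id]; ring
  rw [hsum, h1, mul_one]

/-- The mean square deviation of the magnitude of the pruning, relative to `n`, from `1 / 4`. -/
noncomputable def pruneDeviation (n : ℕ) : ℝ :=
  ∑ m ∈ Finset.range (n + 1), pruneLaw n m * ((m : ℝ) / n - 1 / 4) ^ 2

theorem pruneDeviation_nonneg (n : ℕ) : 0 ≤ pruneDeviation n :=
  Finset.sum_nonneg fun m _ => mul_nonneg (pruneLaw_nonneg n m) (sq_nonneg _)

theorem pruneDeviation_le {n : ℕ} (hn : 5 ≤ n) : pruneDeviation n ≤ 1 / n := by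
  have h0 := sum_pruneLaw (n := n) (by omega)
  have h1 := pruneLaw_first_moment (n := n) (by omega)
  have h2 := pruneLaw_second_moment (n := n) (by omega)
  have hn' : (5 : ℝ) ≤ n := by exact_mod_cast hn
  have h : pruneDeviation n * (16 * n ^ 2) =
      16 * (∑ m ∈ Finset.range (n + 1), pruneLaw n m * (m : ℝ) ^ 2)
      - 8 * n * (∑ m ∈ Finset.range (n + 1), pruneLaw n m * m)
      + n ^ 2 * (∑ m ∈ Finset.range (n + 1), pruneLaw n m) := by
    simp only [pruneDeviation, Finset.sum_mul, Finset.mul_sum]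
    rw [← Finset.sum_sub_distrib, ← Finset.sum_add_distrib]
    refine Finset.sum_congr rfl fun m _ => ?_
    field_simp
    ring
  rw [h0] at h
  generalize ∑ m ∈ Finset.range (n + 1), pruneLaw n m * (m : ℝ) ^ 2 = M₂ at *
  generalize ∑ m ∈ Finset.range (n + 1), pruneLaw n m * (m : ℝ) = M₁ at *
  have hD : pruneDeviation n * n * (16 * ((2 * n - 3) * (2 * n - 5))) =
      4 * n ^ 2 - 17 * n + 16 := by
    have hn0 : (n : ℝ) ≠ 0 := by positivity
    refine mul_left_cancel₀ (mul_ne_zero four_ne_zero hn0) ?_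
    linear_combination 4 * (2 * n - 3) * (2 * n - 5) * h + 16 * 2 * (2 * n - 3) * h2 +
      (16 * (n ^ 2 - 5 * n + 2) - 16 * n * (2 * n - 5)) * h1
  have hpos : 0 < 16 * ((2 * n - 3) * (2 * n - 5) : ℝ) := by
    have : (0 : ℝ) < 2 * n - 3 := by linarith
    have : (0 : ℝ) < 2 * n - 5 := by linarith
    positivity
  rw [le_div_iff₀ (by positivity)]
  refine le_of_mul_le_mul_right ?_ hpos
  nlinarith

theorem tendsto_pruneDeviation : Tendsto pruneDeviation atTop (𝓝 0) := by
  refine squeeze_zero' (Eventually.of_forall pruneDeviation_nonneg) ?_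
    tendsto_one_div_atTop_nhds_zero_nat
  filter_upwards [eventually_ge_atTop 5] with n hn using pruneDeviation_le hn

/-- Averaging a bounded null sequence over the law of the magnitude of the pruning. -/
theorem tendsto_sum_pruneLaw_mul {q : ℕ → ℝ} (hq0 : ∀ m, 0 ≤ q m) (hq1 : ∀ m, q m ≤ 1)
    (hq : Tendsto q atTop (𝓝 0)) :
    Tendsto (fun n => ∑ m ∈ Finset.range (n + 1), pruneLaw n m * q m) atTop (𝓝 0) := by
  rw [Metric.tendsto_atTop] at hq
  rw [tendsto_order]
  refine ⟨fun a ha => Eventually.of_forall fun n => ha.trans_le <|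
    Finset.sum_nonneg fun m _ => mul_nonneg (pruneLaw_nonneg n m) (hq0 m), fun δ hδ => ?_⟩
  obtain ⟨M, hM⟩ := hq (δ / 2) (half_pos hδ)
  have hdev : ∀ᶠ n in atTop, 64 * pruneDeviation n < δ / 2 := by
    have := tendsto_pruneDeviation.const_mul 64
    rw [mul_zero] at this
    exact this.eventually_lt_const (half_pos hδ)
  filter_upwards [hdev, eventually_ge_atTop 2, eventually_ge_atTop (8 * M)] with n hn hn2 hnM
  have hbound : ∀ m, q m ≤ δ / 2 + 64 * ((m : ℝ) / n - 1 / 4) ^ 2 := by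
    intro m
    by_cases hm : M ≤ m
    · have := hM m hm
      rw [Real.dist_0_eq_abs, abs_of_nonneg (hq0 m)] at this
      have := sq_nonneg ((m : ℝ) / n - 1 / 4)
      linarith
    · have hmn : (m : ℝ) / n ≤ 1 / 8 := by
        rw [div_le_iff₀ (by positivity)]
        have : (8 * m : ℝ) ≤ n := by exact_mod_cast (by omega : 8 * m ≤ n)
        linarith
      have := hq1 m
      nlinarith
  calc ∑ m ∈ Finset.range (n + 1), pruneLaw n m * q m
      ≤ ∑ m ∈ Finset.range (n + 1), (δ / 2 * pruneLaw n m +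
          64 * (pruneLaw n m * ((m : ℝ) / n - 1 / 4) ^ 2)) := by
        refine Finset.sum_le_sum fun m _ => ?_
        have := mul_le_mul_of_nonneg_left (hbound m) (pruneLaw_nonneg n m)
        linarith
    _ = δ / 2 + 64 * pruneDeviation n := by
        rw [Finset.sum_add_distrib, ← Finset.mul_sum, ← Finset.mul_sum, sum_pruneLaw hn2,
          mul_one, pruneDeviation]
    _ < δ := by linarith

theorem expect_eq_sum_pruneLaw {n : ℕ} (hn : 2 ≤ n) {f h : BinTree → ℝ}
    (hfh : ∀ τ σ, τ.magnitude = n → τ.prune = some σ → f τ = h σ) :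
    expect n f = ∑ m ∈ Finset.range (n + 1), pruneLaw n m * expect m h := by
  rw [expect, sum_treesOf_of_prune hn hfh, Finset.sum_div]
  refine Finset.sum_congr rfl fun m _ => ?_
  rcases Nat.eq_zero_or_pos m with rfl | hm
  · simp [treesOf, pruneLaw]
  · have := (card_treesOf_pos hm).ne'
    rw [pruneLaw, expect]
    field_simp

/-- The indicator of a deviation of the bifurcation ratio of order `r` from `1 / 4`. -/
noncomputable def ratioDeviates (ε : ℝ) (r : ℕ) (τ : BinTree) : ℝ :=
  if ε < |(BinTree.branches (r + 1) τ : ℝ) / (BinTree.branches r τ : ℝ) - 1 / 4| then 1 else 0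

theorem ratioDeviates_nonneg (ε : ℝ) (r : ℕ) (τ : BinTree) : 0 ≤ ratioDeviates ε r τ := by
  rw [ratioDeviates]
  split_ifs <;> norm_num

theorem ratioDeviates_le_one (ε : ℝ) (r : ℕ) (τ : BinTree) : ratioDeviates ε r τ ≤ 1 := by
  rw [ratioDeviates]
  split_ifs <;> norm_num

theorem expect_ratioDeviates_nonneg (ε : ℝ) (r n : ℕ) : 0 ≤ expect n (ratioDeviates ε r) :=
  div_nonneg (Finset.sum_nonneg fun τ _ => ratioDeviates_nonneg ε r τ) (Nat.cast_nonneg _)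

theorem expect_ratioDeviates_le_one (ε : ℝ) (r n : ℕ) : expect n (ratioDeviates ε r) ≤ 1 := by
  refine div_le_one_of_le₀ ?_ (Nat.cast_nonneg _)
  simpa using Finset.sum_le_sum fun τ (_ : τ ∈ treesOf n) => ratioDeviates_le_one ε r τ

theorem expect_ratioDeviates_one_le {ε : ℝ} (hε : 0 < ε) {n : ℕ} (hn : 2 ≤ n) :
    expect n (ratioDeviates ε 1) ≤ pruneDeviation n / ε ^ 2 := by
  rw [expect_eq_sum_pruneLaw hn (h := fun σ =>
      if ε < |(σ.magnitude : ℝ) / n - 1 / 4| then 1 else 0), pruneDeviation, Finset.sum_div]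
  · refine Finset.sum_le_sum fun m _ => ?_
    rw [mul_div_assoc]
    refine mul_le_mul_of_nonneg_left ?_ (pruneLaw_nonneg n m)
    refine div_le_of_le_mul₀ (Nat.cast_nonneg _) (by positivity) ?_
    rw [mul_comm, ← nsmul_eq_mul]
    refine Finset.sum_le_card_nsmul _ _ _ fun σ hσ => ?_
    simp only [mem_treesOf.mp hσ]
    split_ifs with h
    · rw [one_le_div (by positivity), ← sq_abs ((m : ℝ) / n - 1 / 4)]
      exact pow_le_pow_left₀ hε.le h.le 2
    · positivity
  · intro τ σ hτ hσ
    simp only [ratioDeviates]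
    rw [branches_one, hτ, branches_of_prune_eq_some le_rfl hσ, branches_one]

theorem tendsto_expect_ratioDeviates {ε : ℝ} (hε : 0 < ε) {r : ℕ} (hr : 1 ≤ r) :
    Tendsto (fun n => expect n (ratioDeviates ε r)) atTop (𝓝 0) := by
  induction r, hr using Nat.le_induction with
  | base =>
    refine squeeze_zero' (Eventually.of_forall (expect_ratioDeviates_nonneg ε 1)) ?_
      (by simpa using tendsto_pruneDeviation.div_const (ε ^ 2))
    filter_upwards [eventually_ge_atTop 2] with n hn using expect_ratioDeviates_one_le hε hn
  | succ r hr ih =>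
    refine (tendsto_sum_pruneLaw_mul (expect_ratioDeviates_nonneg ε r)
      (expect_ratioDeviates_le_one ε r) ih).congr' ?_
    filter_upwards [eventually_ge_atTop 2] with n hn
    refine (expect_eq_sum_pruneLaw hn fun τ σ _ hσ => ?_).symm
    simp only [ratioDeviates]
    rw [branches_of_prune_eq_some hr hσ, branches_of_prune_eq_some (by omega) hσ]

open scoped Classical in
/-- Horton's law of stream numbers for the random model: for `r ≥ 1` the bifurcation ratio
`S_{r+1,n}/S_{r,n}` converges in probability to `1/4`:
`P_n(|S_{r+1,n}/S_{r,n} − 1/4| > ε) → 0` for every `ε > 0`. -/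
theorem hortons_law_stream_numbers (r : ℕ) (hr : 1 ≤ r) :
    ∀ ε : ℝ, 0 < ε →
      Tendsto (fun n : ℕ =>
          (((treesOf n).filter (fun τ =>
              ε < |(BinTree.branches (r+1) τ : ℝ) / (BinTree.branches r τ : ℝ) - 1/4|)).card : ℝ)
            / (treesOf n).card)
        atTop (𝓝 0) := by
  intro ε hε
  refine (tendsto_expect_ratioDeviates hε hr).congr fun n => ?_
  simp only [expect, ratioDeviates, Finset.sum_boole]
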